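/- arXiv:2503.13071 — 3 statements merged into one kernel-verified Lean document; each statement's English description precedes it below -/
import Mathlib

section
/- Fix an integer d ≥ 2 and α ∈ (0,2). There exists a constant c > 0 (depending only on d and α) such that for all x, z ∈ ℝ^d with |x| = 1 < |z|, one has ∫_{B(0,1)} (1−|a|²)^{α/2} / ( |a−z|^{d+α} |a−x|^{d} ) da ≤ c / ( |z−x|^{d} (|z|²−1)^{α/2} ), the integral being with respect to Lebesgue measure on the open unit ball B(0,1) ⊂ ℝ^d. -/
open MeasureTheory Metric Set
open scoped ENNReal

noncomputable section

def gg (d : ℕ) (p δ t : ℝ) : ℝ := t ^ (p - d) * (max t δ) ^ (-(2 * p))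

lemma gg_nonneg (d : ℕ) (p δ t : ℝ) (ht : 0 ≤ t) : 0 ≤ gg d p δ t := by
  unfold gg
  have : 0 ≤ max t δ := le_max_of_le_left ht
  positivity

lemma gg_integrable (d : ℕ) (hd : 2 ≤ d) (p : ℝ) (hp : 0 < p) :
    Integrable (fun y : EuclideanSpace ℝ (Fin d) => gg d p 1 ‖y‖) := by
  have : Nontrivial (EuclideanSpace ℝ (Fin d)) := by
    have : Nontrivial (Fin d) := Fin.nontrivial_iff_two_le.2 hd
    infer_instance
  rw [integrable_fun_norm_addHaar (μ := volume) (f := gg d p 1)]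
  rw [finrank_euclideanSpace_fin]
  have key : ∀ y : ℝ, 0 < y → y ^ (d - 1) * y ^ (p - d) = y ^ (p - 1) := by
    intro y hy
    rw [← Real.rpow_natCast, ← Real.rpow_add hy, Nat.cast_sub (by omega)]
    congr 1
    push_cast
    ring
  rw [← Ioo_union_Ici_eq_Ioi zero_lt_one]
  refine IntegrableOn.union ?_ ?_
  · have h := (intervalIntegral.integrableOn_Ioo_rpow_iff (s := p - 1) (zero_lt_one (α := ℝ))).2
      (by linarith)
    refine h.congr_fun ?_ measurableSet_Ioo
    intro y hy
    simp only [gg, smul_eq_mul]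
    rw [max_eq_right hy.2.le, Real.one_rpow, mul_one, key y hy.1]
  · rw [integrableOn_Ici_iff_integrableOn_Ioi]
    have h := integrableOn_Ioi_rpow_of_lt (a := -p - 1) (by linarith) (zero_lt_one (α := ℝ))
    refine h.congr_fun ?_ measurableSet_Ioi
    intro y hy
    have hy' : (1:ℝ) < y := hy
    have hy0 : (0:ℝ) < y := by linarith
    simp only [gg, smul_eq_mul]
    rw [max_eq_left hy'.le, ← mul_assoc, key y hy0, ← Real.rpow_add hy0]
    congr 1
    ring

lemma gg_scale (d : ℕ) (p δ t : ℝ) (hδ : 0 < δ) (ht : 0 ≤ t) :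
    gg d p δ t = δ ^ (-p - d) * gg d p 1 (δ⁻¹ * t) := by
  unfold gg
  have h1 : max t δ = δ * max (δ⁻¹ * t) 1 := by
    rw [mul_max_of_nonneg _ _ hδ.le, mul_inv_cancel_left₀ hδ.ne', mul_one]
  rw [h1, Real.mul_rpow hδ.le (by positivity), Real.mul_rpow (by positivity) ht,
    Real.inv_rpow hδ.le, ← Real.rpow_neg hδ.le]
  have : δ ^ (-p - d) * δ ^ (-(p - d)) = δ ^ (-(2 * p)) := by
    rw [← Real.rpow_add hδ]; congr 1; ring
  rw [← this]; ring

lemma gg_lintegral (d : ℕ) (hd : 2 ≤ d) (p : ℝ) (hp : 0 < p) :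
    ∃ K : ℝ, 0 ≤ K ∧ ∀ (δ : ℝ) (b : EuclideanSpace ℝ (Fin d)), 0 < δ →
      Measurable (fun a : EuclideanSpace ℝ (Fin d) => ENNReal.ofReal (gg d p δ ‖a - b‖)) ∧
      ∫⁻ a : EuclideanSpace ℝ (Fin d), ENNReal.ofReal (gg d p δ ‖a - b‖)
        = ENNReal.ofReal (K * δ ^ (-p)) := by
  refine ⟨∫ y : EuclideanSpace ℝ (Fin d), gg d p 1 ‖y‖,
    integral_nonneg fun y => gg_nonneg _ _ _ _ (norm_nonneg _), fun δ b hδ => ⟨?_, ?_⟩⟩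
  · unfold gg; fun_prop
  rw [lintegral_sub_right_eq_self
    (fun a : EuclideanSpace ℝ (Fin d) => ENNReal.ofReal (gg d p δ ‖a‖)) b]
  have e : (fun a : EuclideanSpace ℝ (Fin d) => gg d p δ ‖a‖)
      = fun a => δ ^ (-p - d) * gg d p 1 ‖δ⁻¹ • a‖ := by
    funext a
    rw [gg_scale d p δ _ hδ (norm_nonneg _), norm_smul, Real.norm_of_nonneg (by positivity)]
  have hi : Integrable (fun a : EuclideanSpace ℝ (Fin d) => gg d p δ ‖a‖) := by
    rw [e]
    exact ((gg_integrable d hd p hp).comp_smul (inv_ne_zero hδ.ne')).const_mul _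
  rw [← ofReal_integral_eq_lintegral_ofReal hi
    (Filter.Eventually.of_forall fun y => gg_nonneg _ _ _ _ (norm_nonneg _)), e]
  congr 1
  rw [integral_const_mul, Measure.integral_comp_inv_smul volume
    (fun a : EuclideanSpace ℝ (Fin d) => gg d p 1 ‖a‖) δ, finrank_euclideanSpace_fin,
    abs_of_pos (by positivity), smul_eq_mul, ← mul_assoc, ← Real.rpow_natCast,
    ← Real.rpow_add hδ]
  rw [mul_comm]
  congr 2
  ring

/-- pointwise bound, general -/
lemma pt1 (d : ℕ) (p δ s u v ρ : ℝ) (hp : 0 < p) (hδ : 0 < δ) (hs : 0 ≤ s) (hu : 0 < u)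
    (hv : δ ≤ v) (hsu : s ≤ 2 * u) (hsv : s ≤ 2 * v) (hρ : 0 < ρ) (hr : ρ ≤ u + v) :
    s ^ p / (v ^ ((d : ℝ) + 2 * p) * u ^ (d : ℝ)) ≤
      (2 ^ p * 2 ^ (d : ℝ) / ρ ^ (d : ℝ)) * (gg d p δ u + gg d p δ v) := by
  have hv0 : 0 < v := by linarith
  have gu := gg_nonneg d p δ u hu.le
  have gv := gg_nonneg d p δ v hv0.le
  rcases le_total u v with h | h
  · calc s ^ p / (v ^ ((d : ℝ) + 2 * p) * u ^ (d : ℝ))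
        ≤ (2 * u) ^ p / (((ρ / 2) ^ (d : ℝ) * (max u δ) ^ (2 * p)) * u ^ (d : ℝ)) := by
          rw [Real.rpow_add hv0]
          have : 0 < max u δ := lt_max_of_lt_left hu
          gcongr
          · linarith
          · exact max_le h hv
      _ = (2 ^ p * 2 ^ (d : ℝ) / ρ ^ (d : ℝ)) * gg d p δ u := by
          have : 0 < max u δ := lt_max_of_lt_left hu
          unfold gg
          rw [Real.mul_rpow (by norm_num) hu.le, Real.div_rpow hρ.le (by norm_num),
            Real.rpow_sub hu, Real.rpow_neg this.le]
          field_simp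
      _ ≤ _ := by gcongr; linarith
  · calc s ^ p / (v ^ ((d : ℝ) + 2 * p) * u ^ (d : ℝ))
        ≤ (2 * v) ^ p / (v ^ ((d : ℝ) + 2 * p) * (ρ / 2) ^ (d : ℝ)) := by
          gcongr
          linarith
      _ = (2 ^ p * 2 ^ (d : ℝ) / ρ ^ (d : ℝ)) * gg d p δ v := by
          unfold gg
          rw [max_eq_left hv, Real.mul_rpow (by norm_num) hv0.le,
            Real.div_rpow hρ.le (by norm_num),
            Real.rpow_sub hv0, Real.rpow_neg hv0.le, Real.rpow_add hv0]
          field_simp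
      _ ≤ _ := by gcongr; linarith

/-- pointwise bound, far -/
lemma pt2 (d : ℕ) (p δ s u v : ℝ) (hp : 0 < p) (hδ : 0 < δ) (hs : 0 ≤ s) (hu : 0 < u)
    (hv : δ ≤ v) (hsu : s ≤ 2 * u) (hu2 : u ≤ 2) :
    s ^ p / (v ^ ((d : ℝ) + 2 * p) * u ^ (d : ℝ)) ≤
      (2 ^ p * 2 ^ (2 * p) / δ ^ ((d : ℝ) + 2 * p)) * gg d p 2 u := by
  have hv0 : 0 < v := by linarith
  calc s ^ p / (v ^ ((d : ℝ) + 2 * p) * u ^ (d : ℝ))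
        ≤ (2 * u) ^ p / (δ ^ ((d : ℝ) + 2 * p) * u ^ (d : ℝ)) := by
          gcongr
      _ = _ := by
          unfold gg
          rw [max_eq_right hu2, Real.mul_rpow (by norm_num) hu.le,
            Real.rpow_sub hu, Real.rpow_neg (by norm_num)]
          field_simp

theorem stmt_2 (d : ℕ) (hd : 2 ≤ d) (α : ℝ) (hα : α ∈ Set.Ioo (0 : ℝ) 2) :
    ∃ c : ℝ, 0 < c ∧ ∀ x z : EuclideanSpace ℝ (Fin d), ‖x‖ = 1 → 1 < ‖z‖ →
      (∫⁻ a in Metric.ball (0 : EuclideanSpace ℝ (Fin d)) 1,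
          ENNReal.ofReal
            ((1 - ‖a‖ ^ 2) ^ (α / 2) / (‖a - z‖ ^ ((d : ℝ) + α) * ‖a - x‖ ^ (d : ℝ))))
        ≤ ENNReal.ofReal (c / (‖z - x‖ ^ (d : ℝ) * (‖z‖ ^ 2 - 1) ^ (α / 2))) := by
  obtain ⟨p, rfl⟩ : ∃ p, α = 2 * p := ⟨α / 2, by ring⟩
  have hp : 0 < p := by linarith [hα.1]
  obtain ⟨K, hK, hJ⟩ := gg_lintegral d hd p hp
  rw [show 2 * p / 2 = p by ring]
  set c1 : ℝ := 2 ^ p * 2 ^ (d : ℝ) * (2 * K) * 3 ^ p with hc1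
  set c2 : ℝ := 2 ^ p * 2 ^ (2 * p) * (K * 2 ^ (-p)) * 3 ^ (d : ℝ) * 3 ^ p with hc2
  have hc1' : 0 ≤ c1 := by positivity
  have hc2' : 0 ≤ c2 := by positivity
  refine ⟨c1 + c2 + 1, by positivity, fun x z hx hz => ?_⟩
  set δ := ‖z‖ - 1 with hδd
  set ρ := ‖z - x‖ with hρd
  have hδ : 0 < δ := by linarith
  have hδρ : δ ≤ ρ := by
    have := norm_sub_norm_le z x
    linarith
  have hρ : 0 < ρ := by linarith
  have hρ2 : ρ ≤ δ + 2 := by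
    have := norm_sub_le z x
    linarith
  have hw : 0 < ‖z‖ ^ 2 - 1 := by nlinarith
  have fact : ∀ a ∈ ball (0 : EuclideanSpace ℝ (Fin d)) 1,
      0 ≤ 1 - ‖a‖ ^ 2 ∧ 0 < ‖a - x‖ ∧ δ ≤ ‖a - z‖ ∧ 1 - ‖a‖ ^ 2 ≤ 2 * ‖a - x‖ ∧
      1 - ‖a‖ ^ 2 ≤ 2 * ‖a - z‖ ∧ ρ ≤ ‖a - x‖ + ‖a - z‖ ∧ ‖a - x‖ ≤ 2 := by
    intro a ha
    rw [mem_ball_zero_iff] at ha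
    have h0 := norm_nonneg a
    have h1 := norm_sub_norm_le x a
    have h2 := norm_sub_norm_le z a
    have h3 := norm_sub_le a x
    have h4 : ρ ≤ ‖z - a‖ + ‖a - x‖ := norm_sub_le_norm_sub_add_norm_sub z a x
    rw [norm_sub_rev x a] at h1
    rw [norm_sub_rev z a] at h2 h4
    refine ⟨by nlinarith, by linarith, by linarith, by nlinarith, by nlinarith, by linarith,
      by linarith⟩
  rcases le_total δ 1 with h | h
  · calc _ ≤ ∫⁻ a in Metric.ball (0 : EuclideanSpace ℝ (Fin d)) 1,
            ENNReal.ofReal (2 ^ p * 2 ^ (d : ℝ) / ρ ^ (d : ℝ)) *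
              (ENNReal.ofReal (gg d p δ ‖a - x‖) + ENNReal.ofReal (gg d p δ ‖a - z‖)) := by
          refine setLIntegral_mono' measurableSet_ball fun a ha => ?_
          obtain ⟨f1, f2, f3, f4, f5, f6, f7⟩ := fact a ha
          rw [← ENNReal.ofReal_add (gg_nonneg _ _ _ _ (norm_nonneg _))
            (gg_nonneg _ _ _ _ (norm_nonneg _)), ← ENNReal.ofReal_mul (by positivity)]
          exact ENNReal.ofReal_le_ofReal (pt1 d p δ _ _ _ ρ hp hδ f1 f2 f3 f4 f5 hρ f6)
      _ ≤ ∫⁻ a : EuclideanSpace ℝ (Fin d),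
            ENNReal.ofReal (2 ^ p * 2 ^ (d : ℝ) / ρ ^ (d : ℝ)) *
              (ENNReal.ofReal (gg d p δ ‖a - x‖) + ENNReal.ofReal (gg d p δ ‖a - z‖)) :=
          setLIntegral_le_lintegral _ _
      _ = ENNReal.ofReal (2 ^ p * 2 ^ (d : ℝ) / ρ ^ (d : ℝ) * (K * δ ^ (-p) + K * δ ^ (-p))) := by
          rw [lintegral_const_mul' _ _ ENNReal.ofReal_ne_top,
            lintegral_add_left (hJ δ x hδ).1, (hJ δ x hδ).2, (hJ δ z hδ).2,
            ← ENNReal.ofReal_add (by positivity) (by positivity),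
            ← ENNReal.ofReal_mul (by positivity)]
      _ ≤ _ := by
          apply ENNReal.ofReal_le_ofReal
          have hb : δ ^ (-p) ≤ 3 ^ p / (‖z‖ ^ 2 - 1) ^ p := by
            rw [← Real.div_rpow (by norm_num) hw.le, Real.rpow_neg hδ.le, ← Real.inv_rpow hδ.le]
            apply Real.rpow_le_rpow (by positivity) _ hp.le
            rw [inv_eq_one_div, div_le_div_iff₀ hδ hw]
            nlinarith
          calc _ ≤ 2 ^ p * 2 ^ (d : ℝ) / ρ ^ (d : ℝ) *
                (K * (3 ^ p / (‖z‖ ^ 2 - 1) ^ p) + K * (3 ^ p / (‖z‖ ^ 2 - 1) ^ p)) := by gcongr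
            _ = c1 / (ρ ^ (d : ℝ) * (‖z‖ ^ 2 - 1) ^ p) := by
                rw [hc1]; field_simp; ring
            _ ≤ _ := by gcongr; linarith
  · calc _ ≤ ∫⁻ a in Metric.ball (0 : EuclideanSpace ℝ (Fin d)) 1,
            ENNReal.ofReal (2 ^ p * 2 ^ (2 * p) / δ ^ ((d : ℝ) + 2 * p)) *
              ENNReal.ofReal (gg d p 2 ‖a - x‖) := by
          refine setLIntegral_mono' measurableSet_ball fun a ha => ?_
          obtain ⟨f1, f2, f3, f4, f5, f6, f7⟩ := fact a ha
          rw [← ENNReal.ofReal_mul (by positivity)]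
          exact ENNReal.ofReal_le_ofReal (pt2 d p δ _ _ _ hp hδ f1 f2 f3 f4 f7)
      _ ≤ ∫⁻ a : EuclideanSpace ℝ (Fin d),
            ENNReal.ofReal (2 ^ p * 2 ^ (2 * p) / δ ^ ((d : ℝ) + 2 * p)) *
              ENNReal.ofReal (gg d p 2 ‖a - x‖) :=
          setLIntegral_le_lintegral _ _
      _ = ENNReal.ofReal (2 ^ p * 2 ^ (2 * p) / δ ^ ((d : ℝ) + 2 * p) * (K * 2 ^ (-p))) := by
          rw [lintegral_const_mul' _ _ ENNReal.ofReal_ne_top, (hJ 2 x (by norm_num)).2,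
            ← ENNReal.ofReal_mul (by positivity)]
      _ ≤ _ := by
          apply ENNReal.ofReal_le_ofReal
          have hb : ρ ^ (d : ℝ) * (‖z‖ ^ 2 - 1) ^ p ≤
              3 ^ (d : ℝ) * 3 ^ p * δ ^ ((d : ℝ) + 2 * p) := by
            calc _ ≤ (3 * δ) ^ (d : ℝ) * (3 * δ ^ 2) ^ p := by
                  gcongr
                  · linarith
                  · nlinarith
              _ = _ := by
                  rw [Real.mul_rpow (by norm_num) hδ.le, Real.mul_rpow (by norm_num) (by positivity),
                    Real.rpow_add hδ, Real.rpow_mul hδ.le, Real.rpow_two]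
                  ring
          calc _ = c2 / (3 ^ (d : ℝ) * 3 ^ p * δ ^ ((d : ℝ) + 2 * p)) := by
                rw [hc2]; field_simp
            _ ≤ c2 / (ρ ^ (d : ℝ) * (‖z‖ ^ 2 - 1) ^ p) := by gcongr
            _ ≤ _ := by gcongr; linarith
end
end

section
/- Let α ∈ (0,2). For every a > 0, the function b ↦ [ ((a+b)₊)^{α/2} − a^{α/2} − (α/2) a^{α/2−1} b 1_{|b|<1} ] / |b|^{1+α} is Lebesgue-integrable on ℝ, and ∫_ℝ [ ((a+b)₊)^{α/2} − a^{α/2} − (α/2) a^{α/2−1} b 1_{|b|<1} ] |b|^{−1−α} db = 0. Equivalently, the fractional generator 𝒦ψ(a) = ∫_ℝ [ ψ((a+b)₊) − ψ(a) − ψ'(a) b 1_{|b|<1} ] |b|^{−1−α} db of the one-dimensional symmetric α-stable process absorbed at 0 annihilates the function ψ*(a) = a^{α/2} at every a ∈ (0,∞). -/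
open MeasureTheory Set

noncomputable section

lemma bern_bound {s x : ℝ} (hs0 : 0 < s) (hs1 : s < 1) (hx : -(1/2) ≤ x) :
    |(1 + x) ^ s - 1 - s * x| ≤ 2 * s * x ^ 2 := by
  have h1 : (1 + x) ^ s ≤ 1 + s * x :=
    rpow_one_add_le_one_add_mul_self (by linarith) hs0.le hs1.le
  have h2 : (1 + x) ^ (1 - s) ≤ 1 + (1 - s) * x :=
    rpow_one_add_le_one_add_mul_self (by linarith) (by linarith) (by linarith)
  have hpos : 0 < 1 + x := by linarith
  have h3 : (1 + x) ^ s * (1 + x) ^ (1 - s) = 1 + x := by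
    rw [← Real.rpow_add hpos]; simp
  have hA : 0 < (1 + x) ^ s := Real.rpow_pos_of_pos hpos _
  have hD : 1 / 2 ≤ 1 + (1 - s) * x := by nlinarith
  have h4 : 1 + x ≤ (1 + x) ^ s * (1 + (1 - s) * x) := by
    calc 1 + x = _ := h3.symm
      _ ≤ _ := by gcongr
  rw [abs_le]
  constructor
  · by_contra hcon
    push Not at hcon
    have h5 : (1 + x) ^ s * (1 + (1 - s) * x) < (1 + s * x - 2 * s * x ^ 2) * (1 + (1 - s) * x) := by
      apply mul_lt_mul_of_pos_right _ (by linarith)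
      linarith
    have h6 : (1 + s * x - 2 * s * x ^ 2) * (1 + (1 - s) * x)
      = 1 + x + s * x^2 * ((1 - s) - 2 * (1 + (1 - s) * x)) := by ring
    have : 0 ≤ s * x ^ 2 * (2 * (1 + (1 - s) * x) - (1 - s)) := by
      apply mul_nonneg (by positivity); linarith
    nlinarith
  · have : 0 ≤ 2 * s * x ^ 2 := by positivity
    linarith

lemma meas_kk (s t σ : ℝ) : Measurable (fun b : ℝ =>
    ((max (1 + σ * b) 0) ^ s - 1 - s * (σ * (if |b| < t then b else 0))) * b ^ (-(1:ℝ) - 2 * s)) := by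
  have : Measurable (fun b : ℝ => if |b| < t then b else 0) :=
    Measurable.ite (measurableSet_lt (by fun_prop) (by fun_prop)) (by fun_prop) (by fun_prop)
  fun_prop

lemma intA {s r : ℝ} (hs0 : 0 < s) (hs1 : s < 1) (hr : 0 < r) :
    IntegrableOn (fun b : ℝ => (1 + b) ^ s * b ^ (-(1:ℝ) - 2 * s)) (Ioi r) := by
  have h1 : IntegrableOn (fun b : ℝ => b ^ (-(1:ℝ) - 2 * s)) (Ioi r) :=
    integrableOn_Ioi_rpow_of_lt (by linarith) hr
  have h2 : IntegrableOn (fun b : ℝ => b ^ (-(1:ℝ) - s)) (Ioi r) :=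
    integrableOn_Ioi_rpow_of_lt (by linarith) hr
  refine Integrable.mono' (h1.add h2) (by fun_prop) ?_
  filter_upwards [ae_restrict_mem measurableSet_Ioi] with b hb
  have hb0 : 0 < b := hr.trans hb
  rw [Real.norm_of_nonneg (by positivity)]
  have : (1 + b) ^ s ≤ 1 ^ s + b ^ s :=
    Real.rpow_add_le_add_rpow (by norm_num) hb0.le hs0.le hs1.le
  rw [Real.one_rpow] at this
  have e : b ^ (-(1:ℝ) - s) = b ^ s * b ^ (-(1:ℝ) - 2 * s) := by
    rw [← Real.rpow_add hb0]; ring_nf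
  simp only [Pi.add_apply]
  rw [e]
  calc _ ≤ (1 + b ^ s) * b ^ (-(1:ℝ) - 2 * s) := by gcongr
    _ = _ := by ring

lemma intKK {s t σ : ℝ} (hs0 : 0 < s) (hs1 : s < 1) (ht : 0 < t) (hσ : σ = 1 ∨ σ = -1) :
    IntegrableOn (fun b : ℝ =>
    ((max (1 + σ * b) 0) ^ s - 1 - s * (σ * (if |b| < t then b else 0))) * b ^ (-(1:ℝ) - 2 * s))
    (Ioi 0) := by
  have hσ1 : |σ| = 1 := by rcases hσ with h | h <;> simp [h]
  have hσ2 : σ ^ 2 = 1 := by rcases hσ with h | h <;> simp [h]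
  obtain ⟨r, hr0, hr1, hr2⟩ : ∃ r : ℝ, 0 < r ∧ r ≤ 1 / 2 ∧ r < t :=
    ⟨min (1/2) (t/2), by positivity, min_le_left _ _, (min_le_right _ _).trans_lt (by linarith)⟩
  rw [← Ioc_union_Ioi_eq_Ioi hr0.le]
  refine IntegrableOn.union ?_ ?_
  · have h1 : IntegrableOn (fun b : ℝ => 2 * s * b ^ ((1:ℝ) - 2 * s)) (Ioc 0 r) := by
      have := (intervalIntegral.intervalIntegrable_rpow' (a := 0) (b := r)
        (r := 1 - 2 * s) (by linarith))
      rw [intervalIntegrable_iff_integrableOn_Ioc_of_le hr0.le] at this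
      exact this.const_mul _
    refine Integrable.mono' h1 (meas_kk s t σ).aestronglyMeasurable ?_
    filter_upwards [ae_restrict_mem measurableSet_Ioc] with b hb
    have hb0 : 0 < b := hb.1
    have hb1 := hb.2
    have habs : |σ * b| = b := by rw [abs_mul, hσ1, one_mul, abs_of_pos hb0]
    have hx : -(1/2) ≤ σ * b := by have := neg_abs_le (σ * b); linarith
    rw [if_pos (by rw [abs_of_pos hb0]; linarith), max_eq_left (by linarith), norm_mul,
      Real.norm_of_nonneg (Real.rpow_nonneg hb0.le _), Real.norm_eq_abs]
    have := bern_bound hs0 hs1 hx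
    have e : b ^ ((1:ℝ) - 2 * s) = b ^ 2 * b ^ (-(1:ℝ) - 2 * s) := by
      rw [← Real.rpow_natCast b 2, ← Real.rpow_add hb0]; push_cast; ring_nf
    rw [mul_pow, hσ2, one_mul] at this
    rw [e, ← mul_assoc (2 * s)]
    exact mul_le_mul_of_nonneg_right this (Real.rpow_nonneg hb0.le _)
  · have h1 : IntegrableOn (fun b : ℝ => b ^ (-(1:ℝ) - 2 * s)) (Ioi r) :=
      integrableOn_Ioi_rpow_of_lt (by linarith) hr0
    refine Integrable.mono' ((intA hs0 hs1 hr0).add (h1.const_mul (1 + s * t)))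
      (meas_kk s t σ).aestronglyMeasurable ?_
    filter_upwards [ae_restrict_mem measurableSet_Ioi] with b hb
    have hb0 : 0 < b := hr0.trans hb
    have habs : |σ * b| = b := by rw [abs_mul, hσ1, one_mul, abs_of_pos hb0]
    simp only [Pi.add_apply]
    rw [norm_mul, Real.norm_of_nonneg (Real.rpow_nonneg hb0.le _), Real.norm_eq_abs, ← add_mul]
    gcongr
    have h2 : (max (1 + σ * b) 0) ^ s ≤ (1 + b) ^ s := by
      apply Real.rpow_le_rpow (le_max_right _ _) _ hs0.le
      apply max_le _ (by linarith)
      have := le_abs_self (σ * b); linarith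
    have h3 : 0 ≤ (max (1 + σ * b) 0) ^ s := Real.rpow_nonneg (le_max_right _ _) _
    have h4 : |s * (σ * (if |b| < t then b else 0))| ≤ s * t := by
      rw [abs_mul, abs_mul, hσ1, one_mul, abs_of_pos hs0]
      gcongr
      split_ifs with h
      · exact h.le
      · simpa using ht.le
    rw [abs_le] at h4 ⊢
    constructor <;> linarith [h4.1, h4.2]

lemma intW {s ε δ : ℝ} (hs0 : 0 < s) (hδ : 0 < δ) (hδε : 0 < ε) :
    IntervalIntegrable (fun u : ℝ => (1 - u) ^ (s - 1) * u ^ (-(1:ℝ) - 2 * s)) volume δ ε := by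
  apply IntervalIntegrable.mul_continuousOn
  · have := (intervalIntegral.intervalIntegrable_rpow' (a := 1 - δ) (b := 1 - ε)
        (r := s - 1) (by linarith)).comp_sub_left 1
    simpa using this
  · intro u hu
    have : 0 < u := (lt_min hδ hδε).trans_le hu.1
    exact (Real.continuousAt_rpow_const _ _ (Or.inl this.ne')).continuousWithinAt

lemma contV {s ε δ : ℝ} (q : ℝ) (hs0 : 0 < s) (hδ : 0 < δ) (hδε : 0 < ε) :
    ContinuousOn (fun u : ℝ => (1 - u) ^ s * u ^ q) (uIcc δ ε) := by
  intro u hu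
  have : 0 < u := (lt_min hδ hδε).trans_le hu.1
  apply ContinuousAt.continuousWithinAt
  apply ContinuousAt.mul
  · exact ContinuousAt.rpow_const (by fun_prop) (Or.inr hs0.le)
  · exact Real.continuousAt_rpow_const _ _ (Or.inl this.ne')

lemma ftc {s ε : ℝ} (hs0 : 0 < s) (hε : 0 < ε) (hε1 : ε < 1) :
    (∫ u in ε..1, (1 - u) ^ (s - 1) * u ^ (-(1:ℝ) - 2 * s))
      + (∫ u in ε..1, (1 - u) ^ s * u ^ (-(1:ℝ) - 2 * s))
      = 1 / s * ((1 - ε) ^ s * ε ^ (- 2 * s)) := by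
  have i1 := intW hs0 hε (one_pos : (0:ℝ) < 1)
  have i2 : IntervalIntegrable (fun u : ℝ => (1 - u) ^ s * u ^ (-(1:ℝ) - 2 * s)) volume ε 1 :=
    (contV _ hs0 hε one_pos).intervalIntegrable
  rw [← intervalIntegral.integral_add i1 i2]
  rw [intervalIntegral.integral_eq_sub_of_hasDerivAt_of_le hε1.le
    (f := fun u => -(1 / s) * ((1 - u) ^ s * u ^ (-2 * s))) ?_ ?_ (i1.add i2)]
  · simp [Real.zero_rpow hs0.ne']
  · have := contV (-2 * s) hs0 hε (one_pos : (0:ℝ) < 1)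
    rw [uIcc_of_le hε1.le] at this
    exact this.const_mul _
  · intro u hu
    have hu0 : 0 < u := hε.trans hu.1
    have hu1 : 0 < 1 - u := by linarith [hu.2]
    have d1 : HasDerivAt (fun u : ℝ => (1 - u) ^ s) (-1 * s * (1 - u) ^ (s - 1)) u :=
      ((hasDerivAt_id u).const_sub 1).rpow_const (Or.inl hu1.ne')
    have d2 : HasDerivAt (fun u : ℝ => u ^ (-2 * s)) ((-2 * s) * u ^ (-2 * s - 1)) u :=
      Real.hasDerivAt_rpow_const (Or.inl hu0.ne')
    have d := (d1.mul d2).const_mul (-(1 / s))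
    refine d.congr_deriv ?_
    have e1 : (1 - u) ^ s = (1 - u) ^ (s - 1) * (1 - u) := by
      rw [← Real.rpow_add_one hu1.ne']; ring_nf
    have e2 : u ^ (-2 * s) = u ^ (-(1:ℝ) - 2 * s) * u := by
      rw [← Real.rpow_add_one hu0.ne']; ring_nf
    have e3 : u ^ (-2 * s - 1) = u ^ (-(1:ℝ) - 2 * s) := by ring_nf
    rw [e3, e2, e1]
    field_simp
    ring

lemma subst {s ε : ℝ} (hε : 0 < ε) :
    (∫ b in Ioi ε, (1 + b) ^ s * b ^ (-(1:ℝ) - 2 * s))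
      = ∫ u in (ε / (1 + ε))..1, (1 - u) ^ (s - 1) * u ^ (-(1:ℝ) - 2 * s) := by
  have him : (fun b : ℝ => b / (1 + b)) '' Ioi ε = Ioo (ε / (1 + ε)) 1 := by
    ext u
    constructor
    · rintro ⟨b, hb, rfl⟩
      have hb' : ε < b := hb
      have : 0 < b := hε.trans hb'
      constructor
      · simp only
        rw [div_lt_div_iff₀ (by positivity) (by positivity)]; nlinarith
      · simp only
        rw [div_lt_one (by positivity)]; linarith
    · rintro ⟨h1, h2⟩
      have h3 : 0 < 1 - u := by linarith
      refine ⟨u / (1 - u), ?_, ?_⟩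
      · rw [div_lt_iff₀ (by positivity)] at h1
        rw [mem_Ioi, lt_div_iff₀ h3]; linarith
      · simp only; field_simp; ring
  have hd : ∀ b ∈ Ioi ε, HasDerivWithinAt (fun b : ℝ => b / (1 + b)) (1 / (1 + b) ^ 2) (Ioi ε) b := by
    intro b hb
    have : 0 < b := hε.trans hb
    have h := (hasDerivAt_id b).div ((hasDerivAt_id b).const_add 1) (by simp; positivity)
    refine (h.congr_deriv ?_).hasDerivWithinAt
    simp
  have hinj : InjOn (fun b : ℝ => b / (1 + b)) (Ioi ε) := by
    intro x hx y hy hxy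
    have : 0 < x := hε.trans hx
    have : 0 < y := hε.trans hy
    simp only at hxy
    rw [div_eq_div_iff (by positivity) (by positivity)] at hxy
    linarith
  have key := integral_image_eq_integral_abs_deriv_smul measurableSet_Ioi hd hinj
    (fun u => (1 - u) ^ (s - 1) * u ^ (-(1:ℝ) - 2 * s))
  rw [him] at key
  have hle : ε / (1 + ε) ≤ 1 := by rw [div_le_one (by positivity)]; linarith
  rw [intervalIntegral.integral_of_le hle, integral_Ioc_eq_integral_Ioo, key]
  apply setIntegral_congr_fun measurableSet_Ioi
  intro b hb
  have hb0 : 0 < b := hε.trans hb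
  have h1 : 0 < 1 + b := by positivity
  have e : 1 - b / (1 + b) = (1 + b)⁻¹ := by field_simp; ring
  simp only [smul_eq_mul]
  rw [e, abs_of_pos (by positivity), Real.div_rpow hb0.le h1.le, Real.inv_rpow h1.le,
    ← Real.rpow_neg h1.le, div_eq_mul_inv (b ^ _), ← Real.rpow_neg h1.le, one_div,
    ← Real.rpow_natCast, ← Real.rpow_neg h1.le]
  have : (1 + b) ^ s = (1 + b) ^ (-((2:ℕ):ℝ)) * ((1 + b) ^ (-(s - 1)) * (1 + b) ^ (-(-(1:ℝ) - 2 * s))) := by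
    rw [← Real.rpow_add h1, ← Real.rpow_add h1]; push_cast; ring_nf
  rw [this]; ring

lemma Jbound {s ε : ℝ} (hs0 : 0 < s) (hs1 : s < 1) (hε : 0 < ε) (hε1 : ε ≤ 1 / 2) :
    ε ^ (-(1:ℝ) - 2 * s) * (ε ^ 2 / (1 + ε)) ≤
      (∫ u in (ε / (1 + ε))..ε, (1 - u) ^ (s - 1) * u ^ (-(1:ℝ) - 2 * s)) ∧
    (∫ u in (ε / (1 + ε))..ε, (1 - u) ^ (s - 1) * u ^ (-(1:ℝ) - 2 * s)) ≤
      ε ^ (-(1:ℝ) - 2 * s) * (ε ^ 2 * (1 + ε) ^ 2 / (1 - ε)) := by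
  have hδ0 : 0 < ε / (1 + ε) := by positivity
  have hδ : ε / (1 + ε) ≤ ε := div_le_self hε.le (by linarith)
  have hlen : ε - ε / (1 + ε) = ε ^ 2 / (1 + ε) := by field_simp; ring
  have hW := intW (s := s) hs0 hδ0 hε
  have h1ε : 0 < 1 - ε := by linarith
  constructor
  · have := intervalIntegral.integral_mono_on (f := fun _ => ε ^ (-(1:ℝ) - 2 * s)) hδ
      (by simp) hW ?_
    · rw [intervalIntegral.integral_const, hlen, smul_eq_mul, mul_comm] at this
      exact this
    · intro u hu
      have hu0 : 0 < u := hδ0.trans_le hu.1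
      have a1 : 1 ≤ (1 - u) ^ (s - 1) :=
        Real.one_le_rpow_of_pos_of_le_one_of_nonpos (by linarith [hu.2]) (by linarith) (by linarith)
      have a2 : ε ^ (-(1:ℝ) - 2 * s) ≤ u ^ (-(1:ℝ) - 2 * s) :=
        Real.rpow_le_rpow_of_nonpos hu0 hu.2 (by linarith)
      have := Real.rpow_nonneg hu0.le (-(1:ℝ) - 2 * s)
      nlinarith
  · have := intervalIntegral.integral_mono_on
      (g := fun _ => (1 - ε)⁻¹ * (ε ^ (-(1:ℝ) - 2 * s) * (1 + ε) ^ 3)) hδ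
      hW (by simp) ?_
    · rw [intervalIntegral.integral_const, hlen, smul_eq_mul] at this
      refine this.trans (le_of_eq ?_)
      field_simp
    · intro u hu
      have hu0 : 0 < u := hδ0.trans_le hu.1
      have a1 : (1 - u) ^ (s - 1) ≤ (1 - ε)⁻¹ := by
        calc (1 - u) ^ (s - 1) ≤ (1 - ε) ^ (s - 1) :=
              Real.rpow_le_rpow_of_nonpos h1ε (by linarith [hu.2]) (by linarith)
          _ ≤ (1 - ε) ^ (-1 : ℝ) :=
              Real.rpow_le_rpow_of_exponent_ge h1ε (by linarith) (by linarith)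
          _ = _ := Real.rpow_neg_one _
      have a2 : u ^ (-(1:ℝ) - 2 * s) ≤ ε ^ (-(1:ℝ) - 2 * s) * (1 + ε) ^ 3 := by
        calc u ^ (-(1:ℝ) - 2 * s) ≤ (ε / (1 + ε)) ^ (-(1:ℝ) - 2 * s) :=
              Real.rpow_le_rpow_of_nonpos hδ0 hu.1 (by linarith)
          _ = ε ^ (-(1:ℝ) - 2 * s) * (1 + ε) ^ (-(-(1:ℝ) - 2 * s)) := by
              rw [Real.div_rpow hε.le (by linarith), div_eq_mul_inv, Real.rpow_neg (by linarith)]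
          _ ≤ ε ^ (-(1:ℝ) - 2 * s) * (1 + ε) ^ (3 : ℝ) := by
              gcongr
              · linarith
              · linarith
          _ = _ := by norm_cast
      have : 0 ≤ (1 - ε)⁻¹ := by positivity
      exact mul_le_mul a1 a2 (Real.rpow_nonneg hu0.le _) this

set_option maxHeartbeats 1000000 in
lemma tailH {s ε : ℝ} (hs0 : 0 < s) (hs1 : s < 1) (hε : 0 < ε) (hε1 : ε ≤ 1 / 2) :
    |∫ b in Ioi ε, ((1 + b) ^ s + (max (1 - b) 0) ^ s - 2) * b ^ (-(1:ℝ) - 2 * s)|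
      ≤ 7 * ε ^ (2 - 2 * s) := by
  have h1 : IntegrableOn (fun b : ℝ => b ^ (-(1:ℝ) - 2 * s)) (Ioi ε) :=
    integrableOn_Ioi_rpow_of_lt (by linarith) hε
  have h2 := intA hs0 hs1 hε
  have h3 : IntegrableOn (fun b : ℝ => (max (1 - b) 0) ^ s * b ^ (-(1:ℝ) - 2 * s)) (Ioi ε) := by
    refine Integrable.mono' h1 (by fun_prop) ?_
    filter_upwards [ae_restrict_mem measurableSet_Ioi] with b hb
    have hb0 : 0 < b := hε.trans hb
    rw [Real.norm_of_nonneg (by positivity)]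
    have : (max (1 - b) 0) ^ s ≤ 1 :=
      Real.rpow_le_one (le_max_right _ _) (max_le (by linarith) (by norm_num)) hs0.le
    exact mul_le_of_le_one_left (by positivity) this
  have e : (∫ b in Ioi ε, ((1 + b) ^ s + (max (1 - b) 0) ^ s - 2) * b ^ (-(1:ℝ) - 2 * s))
      = (∫ b in Ioi ε, (1 + b) ^ s * b ^ (-(1:ℝ) - 2 * s))
        + (∫ b in Ioi ε, (max (1 - b) 0) ^ s * b ^ (-(1:ℝ) - 2 * s))
        - 2 * ∫ b in Ioi ε, b ^ (-(1:ℝ) - 2 * s) := by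
    rw [← integral_const_mul, ← integral_add h2 h3]
    have h23 : IntegrableOn (fun b : ℝ => (1 + b) ^ s * b ^ (-(1:ℝ) - 2 * s)
        + (max (1 - b) 0) ^ s * b ^ (-(1:ℝ) - 2 * s)) (Ioi ε) := h2.add h3
    rw [← integral_sub h23 (h1.const_mul 2)]
    congr 1
    ext b
    ring
  have e3 : (∫ b in Ioi ε, (max (1 - b) 0) ^ s * b ^ (-(1:ℝ) - 2 * s))
      = ∫ u in ε..1, (1 - u) ^ s * u ^ (-(1:ℝ) - 2 * s) := by
    rw [intervalIntegral.integral_of_le (by linarith),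
      setIntegral_eq_of_subset_of_forall_sdiff_eq_zero measurableSet_Ioi
        (Ioc_subset_Ioi_self : Ioc ε 1 ⊆ Ioi ε)]
    · apply setIntegral_congr_fun measurableSet_Ioc
      intro b hb
      simp only
      rw [max_eq_left (by linarith [hb.2])]
    · rintro x ⟨hx1, hx2⟩
      have : 1 < x := by
        by_contra h
        exact hx2 ⟨hx1, not_lt.1 h⟩
      rw [max_eq_right (by linarith), Real.zero_rpow hs0.ne', zero_mul]
  have e1 : (∫ b in Ioi ε, b ^ (-(1:ℝ) - 2 * s)) = ε ^ (-2 * s) / (2 * s) := by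
    rw [integral_Ioi_rpow_of_lt (by linarith) hε,
      show -(1:ℝ) - 2 * s + 1 = - (2 * s) by ring, neg_div_neg_eq, neg_mul]
  have hδ0 : 0 < ε / (1 + ε) := by positivity
  have hadd := intervalIntegral.integral_add_adjacent_intervals
    (intW (s := s) hs0 hδ0 hε) (intW (s := s) hs0 hε one_pos)
  have hf := ftc hs0 hε (by linarith : ε < 1)
  obtain ⟨hJ1, hJ2⟩ := Jbound hs0 hs1 hε hε1
  rw [e, subst hε, e3, e1, ← hadd]
  set J := ∫ u in (ε / (1 + ε))..ε, (1 - u) ^ (s - 1) * u ^ (-(1:ℝ) - 2 * s)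
  have hb := bern_bound (x := -ε) hs0 hs1 (by linarith)
  set P := ε ^ (-(1:ℝ) - 2 * s) with hP
  have hPpos : 0 < P := Real.rpow_pos_of_pos hε _
  have p1 : ε ^ (-2 * s) = P * ε := by
    rw [hP, ← Real.rpow_add_one hε.ne']; ring_nf
  have p2 : ε ^ (2 - 2 * s) = P * ε ^ 3 := by
    rw [hP, ← Real.rpow_natCast ε 3, ← Real.rpow_add hε]; push_cast; ring_nf
  rw [p2]
  rw [p1] at hf ⊢
  obtain ⟨y, hy⟩ : ∃ y, y = (1 / s) * ((1 - ε) ^ s - 1 + s * ε) := ⟨_, rfl⟩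
  have hy2 : (1 - ε) ^ s = 1 - s * ε + s * y := by rw [hy]; field_simp; ring
  have hyb : |y| ≤ 2 * ε ^ 2 := by
    have : (1 + -ε) ^ s - 1 - s * -ε = s * y := by
      rw [← sub_eq_add_neg, hy2]; ring
    rw [this, abs_mul, abs_of_pos hs0] at hb
    have : s * |y| ≤ s * (2 * ε ^ 2) := by nlinarith
    exact le_of_mul_le_mul_left this hs0
  have hup : y ≤ 0 := by
    have := rpow_one_add_le_one_add_mul_self (s := -ε) (by linarith) hs0.le hs1.le
    rw [← sub_eq_add_neg, hy2] at this
    by_contra h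
    push Not at h
    nlinarith [mul_pos hs0 h]
  have hlo : -(2 * ε ^ 2) ≤ y := (abs_le.1 hyb).1
  have heq : J + (∫ u in ε..1, (1 - u) ^ (s - 1) * u ^ (-(1:ℝ) - 2 * s))
      + (∫ u in ε..1, (1 - u) ^ s * u ^ (-(1:ℝ) - 2 * s)) - 2 * (P * ε / (2 * s))
      = J + P * ε * (y - ε) := by
    rw [add_assoc, hf, hy2]; field_simp; ring
  rw [heq]
  have q1 : ε ^ 2 - ε ^ 3 ≤ ε ^ 2 / (1 + ε) := by
    rw [le_div_iff₀ (by linarith)]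
    have : 0 ≤ ε ^ 4 := by positivity
    nlinarith
  have q2 : ε ^ 2 * (1 + ε) ^ 2 / (1 - ε) ≤ ε ^ 2 + 7 * ε ^ 3 := by
    rw [div_le_iff₀ (by linarith)]
    have : 0 ≤ ε ^ 3 * (1 - 2 * ε) := mul_nonneg (by positivity) (by linarith)
    nlinarith
  have r1 := mul_le_mul_of_nonneg_left q1 hPpos.le
  have r2 := mul_le_mul_of_nonneg_left q2 hPpos.le
  have hPε : 0 < P * ε := by positivity
  have r3 := mul_le_mul_of_nonneg_left hup hPε.le
  have r4 := mul_le_mul_of_nonneg_left hlo hPε.le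
  have hP3 : 0 < P * ε ^ 3 := by positivity
  rw [abs_le]
  ring_nf at r1 r2 r3 r4 hJ1 hJ2 hP3 ⊢
  constructor <;> linarith

lemma intH {s : ℝ} (hs0 : 0 < s) (hs1 : s < 1)
    (hH : IntegrableOn (fun b : ℝ => ((1 + b) ^ s + (max (1 - b) 0) ^ s - 2) * b ^ (-(1:ℝ) - 2 * s))
      (Ioi 0)) :
    ∫ b in Ioi (0:ℝ), ((1 + b) ^ s + (max (1 - b) 0) ^ s - 2) * b ^ (-(1:ℝ) - 2 * s) = 0 := by
  have ht : Filter.Tendsto (fun x : ℝ => x) (nhdsWithin 0 (Ioi 0)) (nhds 0) :=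
    tendsto_nhdsWithin_of_tendsto_nhds Filter.tendsto_id
  have hc := (aecover_Ioi_of_Ioi (μ := volume) ht).integral_tendsto_of_countably_generated hH
  refine tendsto_nhds_unique hc ?_
  have hz : Filter.Tendsto (fun x : ℝ => 7 * x ^ (2 - 2 * s)) (nhdsWithin 0 (Ioi 0)) (nhds 0) := by
    have := (Real.continuousAt_rpow_const 0 (2 - 2 * s) (Or.inr (by linarith))).tendsto
    rw [Real.zero_rpow (by linarith)] at this
    simpa using (tendsto_nhdsWithin_of_tendsto_nhds this).const_mul 7
  refine squeeze_zero_norm' ?_ hz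
  have : Ioo (0:ℝ) (1/2) ∈ nhdsWithin (0:ℝ) (Ioi 0) := Ioo_mem_nhdsGT (by norm_num)
  filter_upwards [this] with x hx
  rw [Measure.restrict_restrict measurableSet_Ioi,
    inter_eq_left.2 (Ioi_subset_Ioi hx.1.le), Real.norm_eq_abs]
  exact tailH hs0 hs1 hx.1 hx.2.le

lemma unit_case {s t : ℝ} (hs0 : 0 < s) (hs1 : s < 1) (ht : 0 < t) :
    Integrable (fun b : ℝ => ((max (1 + b) 0) ^ s - 1 - s * (if |b| < t then b else 0))
      * |b| ^ (-(1:ℝ) - 2 * s)) ∧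
    ∫ b : ℝ, ((max (1 + b) 0) ^ s - 1 - s * (if |b| < t then b else 0))
      * |b| ^ (-(1:ℝ) - 2 * s) = 0 := by
  set g : ℝ → ℝ := fun b => ((max (1 + b) 0) ^ s - 1 - s * (if |b| < t then b else 0))
      * |b| ^ (-(1:ℝ) - 2 * s) with hg
  have k1 := intKK hs0 hs1 ht (Or.inl rfl : (1:ℝ) = 1 ∨ (1:ℝ) = -1)
  have k2 := intKK hs0 hs1 ht (Or.inr rfl : (-1:ℝ) = 1 ∨ (-1:ℝ) = -1)
  have i1 : IntegrableOn g (Ioi 0) := by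
    refine k1.congr_fun ?_ measurableSet_Ioi
    intro b hb
    have hb0 : 0 < b := hb
    simp only [hg, one_mul, abs_of_pos hb0]
  have i2 : IntegrableOn (fun b => g (-b)) (Ioi 0) := by
    refine k2.congr_fun ?_ measurableSet_Ioi
    intro b hb
    have hb0 : 0 < b := hb
    simp only [hg, abs_neg, abs_of_pos hb0, neg_mul, one_mul]
    split_ifs <;> simp
  have i3 : IntegrableOn g (Iic 0) := by
    have := i2.comp_neg
    rw [integrableOn_Iic_iff_integrableOn_Iio]
    simpa using this
  have i4 : Integrable g := by
    rw [← integrableOn_univ, ← Iic_union_Ioi (a := (0:ℝ))]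
    exact i3.union i1
  refine ⟨i4, ?_⟩
  rw [← intervalIntegral.integral_Iic_add_Ioi i3 i1]
  have := integral_comp_neg_Ioi (0:ℝ) g
  rw [neg_zero] at this
  rw [← this, ← integral_add i2 i1]
  have heq : EqOn (fun b => g (-b) + g b)
      (fun b : ℝ => ((1 + b) ^ s + (max (1 - b) 0) ^ s - 2) * b ^ (-(1:ℝ) - 2 * s)) (Ioi 0) := by
    intro b hb
    have hb0 : 0 < b := hb
    simp only [hg, abs_neg, abs_of_pos hb0]
    rw [max_eq_left (by linarith : 0 ≤ 1 + b), ← sub_eq_add_neg]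
    split_ifs <;> ring
  rw [setIntegral_congr_fun measurableSet_Ioi heq]
  exact intH hs0 hs1 ((i2.add i1).congr_fun heq measurableSet_Ioi)

theorem stmt_6 (α : ℝ) (hα : α ∈ Set.Ioo (0 : ℝ) 2) (a : ℝ) (ha : 0 < a) :
    Integrable (fun b : ℝ =>
      ((max (a + b) 0) ^ (α / 2) - a ^ (α / 2)
          - α / 2 * a ^ (α / 2 - 1) * (if |b| < 1 then b else 0))
        * |b| ^ (-(1 : ℝ) - α)) ∧
    (∫ b : ℝ,
      ((max (a + b) 0) ^ (α / 2) - a ^ (α / 2)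
          - α / 2 * a ^ (α / 2 - 1) * (if |b| < 1 then b else 0))
        * |b| ^ (-(1 : ℝ) - α)) = 0 := by
  obtain ⟨s, rfl⟩ : ∃ s, α = 2 * s := ⟨α / 2, by ring⟩
  have hs0 : 0 < s := by linarith [hα.1]
  have hs1 : s < 1 := by linarith [hα.2]
  rw [show 2 * s / 2 = s by ring]
  set f : ℝ → ℝ := fun b =>
      ((max (a + b) 0) ^ s - a ^ s
          - s * a ^ (s - 1) * (if |b| < 1 then b else 0))
        * |b| ^ (-(1 : ℝ) - 2 * s) with hf
  obtain ⟨u1, u2⟩ := unit_case hs0 hs1 (inv_pos.2 ha)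
  have key : (fun c => f (a * c)) = fun c => (a ^ s * a ^ (-(1:ℝ) - 2 * s)) *
      (((max (1 + c) 0) ^ s - 1 - s * (if |c| < a⁻¹ then c else 0))
      * |c| ^ (-(1:ℝ) - 2 * s)) := by
    ext c
    have m1 : max (a + a * c) 0 = a * max (1 + c) 0 := by
      rw [mul_max_of_nonneg _ _ ha.le]; ring_nf
    have m2 : (|a * c| < 1) ↔ |c| < a⁻¹ := by
      rw [abs_mul, abs_of_pos ha, ← one_div, lt_div_iff₀' ha]
    have m3 : a ^ s = a ^ (s - 1) * a := by
      rw [← Real.rpow_add_one ha.ne']; ring_nf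
    simp only [hf, m1, m2]
    rw [Real.mul_rpow ha.le (le_max_right _ _), abs_mul, abs_of_pos ha,
      Real.mul_rpow ha.le (abs_nonneg _)]
    split_ifs
    · rw [m3]; ring
    · ring
  constructor
  · rw [← integrable_comp_mul_left_iff f ha.ne', key]
    exact u1.const_mul _
  · have h := Measure.integral_comp_mul_left f a
    rw [key, integral_const_mul, u2, mul_zero] at h
    have hne : |a⁻¹| ≠ 0 := by positivity
    rcases smul_eq_zero.1 h.symm with h | h
    · exact absurd h hne
    · exact h
end
end

section
/- Let D ⊂ ℝ^d satisfy Assumption (D) with data (ε₀, η, n). Then there exists a bijection Φ : ℝ^d → ℝ^d such that both Φ and Φ^{−1} are three times continuously differentiable on ℝ^d, sup_{x ∈ ℝ^d} ‖DΦ(x)‖ < ∞ and sup_{x ∈ ℝ^d} ‖DΦ^{−1}(x)‖ < ∞, and Φ(D) = B_d(0,1). Consequently there is κ > 0 such that κ^{−1} |x−y| ≤ |Φ(x) − Φ(y)| ≤ κ |x−y| for all x, y ∈ ℝ^d. -/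
open Metric Set Bornology
open scoped RealInnerProductSpace

noncomputable section

/-- The first vector of the canonical basis of `ℝ^d`. -/
def e1 (d : ℕ) : EuclideanSpace ℝ (Fin d) :=
  if h : 0 < d then EuclideanSpace.single (⟨0, h⟩ : Fin d) 1 else 0

/-- The projection `ℝ^d → ℝ^{d−1}`, `u ↦ (u·e₂, …, u·e_d)`. -/
def projTail (d : ℕ) (u : EuclideanSpace ℝ (Fin d)) :
    EuclideanSpace ℝ (Fin (d - 1)) :=
  (EuclideanSpace.equiv (Fin (d - 1)) ℝ).symm fun i => u ⟨i.1 + 1, by have := i.isLt; omega⟩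

/-- Assumption (D): `D ⊂ ℝ^d` (`d ≥ 2`) is nonempty, open, bounded and convex, `n x` is a
unit vector for `x ∈ ∂D`, and around each boundary point `x` the domain is, in suitable
isometric coordinates sending `e₁` to `n x`, the epigraph of a `C³` uniformly strongly
convex function `ψ` with `ψ(0)=0`, `∇ψ(0)=0`, `Hess ψ ≥ η`, `‖D²ψ‖+‖D³ψ‖ ≤ η⁻¹`. -/
structure AssumptionD (d : ℕ) (D : Set (EuclideanSpace ℝ (Fin d))) (ε₀ η : ℝ)
    (n : EuclideanSpace ℝ (Fin d) → EuclideanSpace ℝ (Fin d)) : Prop where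
  dim_ge : 2 ≤ d
  eps_pos : 0 < ε₀
  eps_lt_one : ε₀ < 1
  eta_pos : 0 < η
  nonempty : D.Nonempty
  isOpen : IsOpen D
  isBounded : Bornology.IsBounded D
  convex : Convex ℝ D
  normal_norm : ∀ x ∈ frontier D, ‖n x‖ = 1
  chart : ∀ x ∈ frontier D,
    ∃ A₀ : EuclideanSpace ℝ (Fin d) →ₗᵢ[ℝ] EuclideanSpace ℝ (Fin d),
      A₀ (e1 d) = n x ∧
      ∃ ψ : EuclideanSpace ℝ (Fin (d - 1)) → ℝ,
        ContDiffOn ℝ 3 ψ (Metric.ball (0 : EuclideanSpace ℝ (Fin (d - 1))) ε₀) ∧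
        (∀ v ∈ Metric.ball (0 : EuclideanSpace ℝ (Fin (d - 1))) ε₀, 0 ≤ ψ v) ∧
        ψ 0 = 0 ∧
        fderiv ℝ ψ 0 = 0 ∧
        (∀ v ∈ Metric.ball (0 : EuclideanSpace ℝ (Fin (d - 1))) ε₀,
          ∀ w : EuclideanSpace ℝ (Fin (d - 1)),
            η * ‖w‖ ^ 2 ≤ iteratedFDeriv ℝ 2 ψ v ![w, w]) ∧
        (∀ v ∈ Metric.ball (0 : EuclideanSpace ℝ (Fin (d - 1))) ε₀,
          ‖iteratedFDeriv ℝ 2 ψ v‖ + ‖iteratedFDeriv ℝ 3 ψ v‖ ≤ η⁻¹) ∧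
        D ∩ Metric.ball x ε₀ =
          (fun u : EuclideanSpace ℝ (Fin d) => x + A₀ u) ''
            {u : EuclideanSpace ℝ (Fin d) |
              u ∈ Metric.ball (0 : EuclideanSpace ℝ (Fin d)) ε₀ ∧
              ψ (projTail d u) < ⟪u, e1 d⟫}

section aux
open Filter Topology

variable {E : Type*} [NormedAddCommGroup E] [InnerProductSpace ℝ E] [FiniteDimensional ℝ E]

lemma slope_bound {m : ℝ → ℝ} {m' c a : ℝ} (hm : HasDerivAt m m' a)
    (h : ∀ᶠ t in 𝓝[>] a, c * (t - a) ≤ m t - m a) : c ≤ m' := by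
  have h1 : Tendsto (slope m a) (𝓝[>] a) (𝓝 m') :=
    (hasDerivAt_iff_tendsto_slope.1 hm).mono_left
      (nhdsWithin_mono _ (fun t (ht : a < t) => ne_of_gt ht))
  refine ge_of_tendsto h1 ?_
  filter_upwards [h, self_mem_nhdsWithin] with t ht hta
  have hta' : 0 < t - a := sub_pos.2 hta
  rw [slope_def_field, le_div_iff₀ hta']
  exact ht

lemma bound_of_homog {F : E → E} (hF : ContDiff ℝ 1 F) (ρ : ℝ) (hρ : 0 < ρ)
    (h : ∀ x, ρ ≤ ‖x‖ → ∀ t : ℝ, 1 ≤ t → F (t • x) = t • F x) :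
    ∃ M : ℝ, ∀ x, ‖fderiv ℝ F x‖ ≤ M := by
  have hc : Continuous (fderiv ℝ F) := hF.continuous_fderiv (by simp)
  obtain ⟨M, hM⟩ := (isCompact_closedBall (0 : E) (2 * ρ)).exists_bound_of_continuousOn
    hc.continuousOn
  have hd : Differentiable ℝ F := hF.differentiable (by simp)
  refine ⟨M, fun x => ?_⟩
  by_cases hx : ‖x‖ ≤ 2 * ρ
  · exact hM x (by simpa using hx)
  push Not at hx
  have hxp : 0 < ‖x‖ := by linarith
  set t := ‖x‖ / (2 * ρ) with ht
  have ht1 : 1 ≤ t := by rw [ht, le_div_iff₀ (by positivity)]; linarith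
  have ht0 : 0 < t := by linarith
  set y := t⁻¹ • x with hy
  have hny : ‖y‖ = 2 * ρ := by
    rw [hy, norm_smul, norm_inv, Real.norm_of_nonneg ht0.le, ht]; field_simp
  have hxy : x = t • y := by rw [hy, smul_inv_smul₀ ht0.ne']
  have he : (fun z => F (t • z)) =ᶠ[𝓝 y] fun z => t • F z := by
    have : ∀ᶠ z in 𝓝 y, ρ < ‖z‖ :=
      (continuous_norm.tendsto y).eventually (lt_mem_nhds (by rw [hny]; linarith))
    filter_upwards [this] with z hz using h z hz.le t ht1
  have h1 : HasFDerivAt (fun z => F (t • z)) ((fderiv ℝ F x).comp (t • ContinuousLinearMap.id ℝ E)) y := by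
    have h2 : HasFDerivAt (fun z : E => t • z) (t • ContinuousLinearMap.id ℝ E) y :=
      (hasFDerivAt_id y).const_smul t
    have h3 : HasFDerivAt F (fderiv ℝ F x) (t • y) := by rw [← hxy]; exact (hd x).hasFDerivAt
    exact h3.comp y h2
  have h2 : HasFDerivAt (fun z => t • F z) (t • fderiv ℝ F y) y := (hd y).hasFDerivAt.const_smul t
  have h3 := h1.unique (h2.congr_of_eventuallyEq he)
  have h4 : fderiv ℝ F x = fderiv ℝ F y := by
    ext1 v
    have := congrArg (fun L : E →L[ℝ] E => L v) h3
    simp only [ContinuousLinearMap.comp_apply, _root_.smul_apply, ContinuousLinearMap.id_apply, map_smul] at this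
    exact smul_right_injective E ht0.ne' this
  rw [h4]
  exact hM y (by simp [hny])

lemma gauge_contDiffAt {S : Set E} (ho : IsOpen S) (hconv : Convex ℝ S) (h0 : (0 : E) ∈ S)
    (hb : Bornology.IsBounded S)
    (hC : ∀ x ∈ frontier S, ∃ h : E → ℝ, ContDiffAt ℝ 3 h x ∧ fderiv ℝ h x ≠ 0 ∧
      ∀ᶠ z in 𝓝 x, (z ∈ S ↔ 0 < h z)) {y₀ : E} (hy₀ : y₀ ≠ 0) :
    ContDiffAt ℝ 3 (gauge S) y₀ := by
  have hS0 : S ∈ 𝓝 (0 : E) := ho.mem_nhds h0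
  have habs : Absorbent ℝ S := absorbent_nhds_zero hS0
  have hpos : ∀ y : E, y ≠ 0 → 0 < gauge S y := fun y hy =>
    (gauge_pos habs (NormedSpace.isVonNBounded_of_isBounded ℝ hb)).2 hy
  have hfr : ∀ y : E, y ≠ 0 → (gauge S y)⁻¹ • y ∈ frontier S := fun y hy => by
    rw [← gauge_eq_one_iff_mem_frontier hconv hS0,
      gauge_smul_of_nonneg (inv_nonneg.2 (gauge_nonneg y)), smul_eq_mul,
      inv_mul_cancel₀ (hpos y hy).ne']
  have hcont : Continuous (gauge S) := continuous_gauge hconv hS0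
  set s₀ := (gauge S y₀)⁻¹ with hs₀
  have hs₀p : 0 < s₀ := inv_pos.2 (hpos _ hy₀)
  set x := s₀ • y₀ with hx
  have hxf : x ∈ frontier S := hfr y₀ hy₀
  obtain ⟨h, hh, hL, hiff⟩ := hC x hxf
  have hzero : ∀ᶠ z in 𝓝 x, z ∈ frontier S → h z = 0 := by
    filter_upwards [hiff.eventually_nhds, hh.eventually (by simp)] with z hz hz2 hzf
    apply le_antisymm
    · by_contra hlt
      push Not at hlt
      have := (hz.self_of_nhds).2 hlt
      rw [ho.frontier_eq] at hzf
      exact hzf.2 this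
    · have hcl : ∃ᶠ w in 𝓝 z, w ∈ S := mem_closure_iff_frequently.1 (frontier_subset_closure hzf)
      exact ge_of_tendsto_of_frequently hz2.continuousAt.tendsto
        ((hcl.and_eventually hz).mono fun w hw => (hw.2.1 hw.1).le)
  have hx0 : h x = 0 := hzero.self_of_nhds hxf
  have hd : HasFDerivAt h (fderiv ℝ h x) x := (hh.differentiableAt (by simp)).hasFDerivAt
  have hLb : ∀ b ∈ S, 0 ≤ fderiv ℝ h x (b - x) := by
    intro b hbS
    have h1 : HasDerivAt (fun t : ℝ => x + t • (b - x)) (b - x) 0 := by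
      simpa using ((hasDerivAt_id (0 : ℝ)).smul_const (b - x)).const_add x
    have h2 : HasDerivAt (fun t : ℝ => h (x + t • (b - x))) (fderiv ℝ h x (b - x)) 0 := by
      have hd' : HasFDerivAt h (fderiv ℝ h x) (x + (0 : ℝ) • (b - x)) := by simpa using hd
      exact hd'.comp_hasDerivAt (0 : ℝ) h1
    refine slope_bound h2 ?_
    have h3 : Tendsto (fun t : ℝ => x + t • (b - x)) (𝓝[>] 0) (𝓝 x) := by
      have := h1.continuousAt.tendsto
      simp only [zero_smul, add_zero] at this
      exact this.mono_left nhdsWithin_le_nhds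
    filter_upwards [h3.eventually hiff, Ioo_mem_nhdsGT (zero_lt_one' ℝ)] with t ht ht1
    have : x + t • (b - x) ∈ interior S :=
      hconv.add_smul_sub_mem_interior' (frontier_subset_closure hxf) (by rwa [ho.interior_eq])
        ⟨ht1.1, ht1.2.le⟩
    have := ht.1 (interior_subset this)
    simp only [zero_smul, add_zero, hx0, zero_mul, sub_zero]
    exact this.le
  have hLx : fderiv ℝ h x x ≠ 0 := by
    intro hLx
    apply hL
    ext w
    have h1 : Tendsto (fun t : ℝ => t • w) (𝓝 0) (𝓝 0) := by
      have : Continuous fun t : ℝ => t • w := by fun_prop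
      simpa using this.tendsto 0
    have h2 : Tendsto (fun t : ℝ => -(t • w)) (𝓝 0) (𝓝 0) := by simpa using h1.neg
    have h3 : ∀ᶠ t : ℝ in 𝓝[>] 0, t • w ∈ S ∧ -(t • w) ∈ S ∧ 0 < t := by
      filter_upwards [nhdsWithin_le_nhds (h1.eventually hS0), nhdsWithin_le_nhds (h2.eventually hS0), self_mem_nhdsWithin]
        with t a b c using ⟨a, b, c⟩
    obtain ⟨t, ha, hb', ht⟩ := h3.exists
    have e1 := hLb _ ha
    have e2 := hLb _ hb'
    simp only [map_sub, map_neg, map_smul, hLx, sub_zero, smul_eq_mul] at e1 e2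
    have : t * fderiv ℝ h x w = 0 := by linarith
    simpa [ht.ne'] using this
  have hLy : fderiv ℝ h x y₀ ≠ 0 := by
    intro h1
    apply hLx
    have h2 : fderiv ℝ h x x = s₀ • fderiv ℝ h x y₀ := by rw [← map_smul]
    rw [h2, h1, smul_zero]
  let F : E × ℝ → ℝ := fun p => h (p.2 • p.1)
  have hF : ContDiffAt ℝ 3 F (y₀, s₀) := by
    have : ContDiffAt ℝ 3 h ((fun p : E × ℝ => p.2 • p.1) (y₀, s₀)) := hh
    exact this.comp (y₀, s₀) (by fun_prop)
  have hinr : ∀ t : ℝ, (fderiv ℝ F (y₀, s₀) ∘L .inr ℝ E ℝ) t = t * fderiv ℝ h x y₀ := by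
    intro t
    have h1 : HasFDerivAt F (fderiv ℝ F (y₀, s₀)) (y₀, s₀) := (hF.differentiableAt (by simp)).hasFDerivAt
    have h2 : HasDerivAt (fun r : ℝ => ((y₀, s₀) : E × ℝ) + r • ((0, t) : E × ℝ)) (0, t) 0 := by
      simpa using ((hasDerivAt_id (0 : ℝ)).smul_const ((0, t) : E × ℝ)).const_add (y₀, s₀)
    have h3 : HasDerivAt (fun r : ℝ => F ((y₀, s₀) + r • ((0, t) : E × ℝ))) (fderiv ℝ F (y₀, s₀) (0, t)) 0 := by
      have h1' : HasFDerivAt F (fderiv ℝ F (y₀, s₀)) ((y₀, s₀) + (0 : ℝ) • ((0, t) : E × ℝ)) := by simpa using h1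
      exact h1'.comp_hasDerivAt (0 : ℝ) h2
    have h4 : HasDerivAt (fun r : ℝ => (s₀ + r * t) • y₀) (t • y₀) 0 := by
      simpa using (((hasDerivAt_id (0 : ℝ)).mul_const t).const_add s₀).smul_const y₀
    have h5 : HasDerivAt (fun r : ℝ => h ((s₀ + r * t) • y₀)) (fderiv ℝ h x (t • y₀)) 0 := by
      have hd' : HasFDerivAt h (fderiv ℝ h x) ((s₀ + 0 * t) • y₀) := by simpa using hd
      exact hd'.comp_hasDerivAt (0 : ℝ) h4
    have h6 : (fun r : ℝ => F ((y₀, s₀) + r • ((0, t) : E × ℝ))) = fun r : ℝ => h ((s₀ + r * t) • y₀) := by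
      ext r; simp [F]
    rw [h6] at h3
    have := h3.unique h5
    simpa using this
  have hinv : (fderiv ℝ F (y₀, s₀) ∘L .inr ℝ E ℝ).IsInvertible := by
    refine ⟨ContinuousLinearEquiv.unitsEquivAut ℝ (Units.mk0 _ hLy), ?_⟩
    ext
    rw [hinr]
    simp
  have hev := hF.eventually_apply_eq_iff_implicitFunction (by simp) hinv
  have hsm := hF.contDiffAt_implicitFunction (by simp) hinv
  have hscont : ContinuousAt (fun y => (gauge S y)⁻¹) y₀ :=
    hcont.continuousAt.inv₀ (hpos _ hy₀).ne'
  have ht1 : Tendsto (fun y => (y, (gauge S y)⁻¹)) (𝓝 y₀) (𝓝 (y₀, s₀)) :=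
    (continuousAt_id.prodMk hscont).tendsto
  have ht2 : Tendsto (fun y => (gauge S y)⁻¹ • y) (𝓝 y₀) (𝓝 x) :=
    (hscont.smul continuousAt_id).tendsto
  have heq : (fun y => (gauge S y)⁻¹) =ᶠ[𝓝 y₀] hF.implicitFunction (by simp) hinv := by
    filter_upwards [ht1.eventually hev, ht2.eventually hzero, eventually_ne_nhds hy₀] with y e1 e2 e3
    refine (e1.1 ?_).symm
    change h _ = h _
    rw [e2 (hfr y e3)]; exact hx0.symm
  have h7 : ContDiffAt ℝ 3 (fun y => (gauge S y)⁻¹) y₀ := hsm.congr_of_eventuallyEq heq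
  have h8 := h7.inv (inv_ne_zero (hpos _ hy₀).ne')
  have h9 : (fun y => (gauge S y)⁻¹)⁻¹ = gauge S := by ext y; simp
  rwa [h9] at h8

lemma radial_diffeo {S : Set E} (ho : IsOpen S) (hconv : Convex ℝ S) (h0 : (0 : E) ∈ S)
    (hb : Bornology.IsBounded S)
    (hC : ∀ x ∈ frontier S, ∃ h : E → ℝ, ContDiffAt ℝ 3 h x ∧ fderiv ℝ h x ≠ 0 ∧
      ∀ᶠ z in 𝓝 x, (z ∈ S ↔ 0 < h z)) :
    ∃ Φ Ψ : E → E, (∀ x, Ψ (Φ x) = x) ∧ (∀ x, Φ (Ψ x) = x) ∧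
      ContDiff ℝ 3 Φ ∧ ContDiff ℝ 3 Ψ ∧
      (∃ M : ℝ, ∀ x, ‖fderiv ℝ Φ x‖ ≤ M) ∧
      (∃ M : ℝ, ∀ x, ‖fderiv ℝ Ψ x‖ ≤ M) ∧
      (∀ y, y ∈ S ↔ ‖Φ y‖ < 1) := by
  have hS0 : S ∈ 𝓝 (0 : E) := ho.mem_nhds h0
  have habs : Absorbent ℝ S := absorbent_nhds_zero hS0
  have hg1 : ∀ y, y ∈ S ↔ gauge S y < 1 := fun y => by
    rw [gauge_lt_one_iff_mem_interior hconv hS0, ho.interior_eq]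
  obtain ⟨r, hr, hrS⟩ := Metric.mem_nhds_iff.1 hS0
  obtain ⟨R, hR, hRS⟩ := hb.subset_closedBall_lt 0 0
  have hgR : ∀ y, ‖y‖ / R ≤ gauge S y := fun y => le_gauge_of_subset_closedBall habs hR.le hRS
  obtain ⟨c, hc, hcg⟩ : ∃ c : ℝ, 0 < c ∧ ∀ y, c * ‖y‖ ≤ gauge S y :=
    ⟨R⁻¹, inv_pos.2 hR, fun y => by have := hgR y; rwa [div_eq_inv_mul] at this⟩
  have hgs : ContDiffOn ℝ 3 (gauge S) {0}ᶜ := fun y hy =>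
    (gauge_contDiffAt ho hconv h0 hb hC hy).contDiffWithinAt
  set G : E → ℝ := fun y => gauge S y * ‖y‖⁻¹ with hGdef
  have hGc : ∀ y, y ≠ 0 → c ≤ G y := fun y hy => by
    have := norm_pos_iff.2 hy
    simp only [hGdef]
    rw [← div_eq_mul_inv, le_div_iff₀ this]; exact hcg y
  have hGh : ∀ y, ∀ t : ℝ, 0 < t → G (t • y) = G y := fun y t ht => by
    simp only [hGdef]
    rw [gauge_smul_of_nonneg ht.le, norm_smul, Real.norm_of_nonneg ht.le, smul_eq_mul, mul_inv]
    field_simp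
  set χ : E → ℝ := fun y => Real.smoothTransition (2 * ‖y‖ ^ 2 / r ^ 2 - 1) with hχ
  have hχ0 : ∀ y, 0 ≤ χ y := fun y => Real.smoothTransition.nonneg _
  have hχ1 : ∀ y, χ y ≤ 1 := fun y => Real.smoothTransition.le_one _
  have hχm : ∀ y z, ‖y‖ ≤ ‖z‖ → χ y ≤ χ z := fun y z h => by
    apply Real.smoothTransition.monotone
    gcongr
  have hχz : ∀ y, 2 * ‖y‖ ^ 2 ≤ r ^ 2 → χ y = 0 := fun y h => by
    apply Real.smoothTransition.zero_of_nonpos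
    rw [sub_nonpos, div_le_one (by positivity)]; exact h
  have hχo : ∀ y, r ≤ ‖y‖ → χ y = 1 := fun y h => by
    apply Real.smoothTransition.one_of_one_le
    have : 1 ≤ ‖y‖ ^ 2 / r ^ 2 := by
      rw [one_le_div (by positivity)]; gcongr
    rw [mul_div_assoc]; linarith
  have hχs : ContDiff ℝ 3 χ := by
    have h1 : ContDiff ℝ 3 Real.smoothTransition := Real.smoothTransition.contDiff (n := 3)
    have h2 : ContDiff ℝ 3 (fun y : E => 2 * ‖y‖ ^ 2 / r ^ 2 - 1) :=
      ((contDiff_const.mul (contDiff_norm_sq ℝ)).div_const _).sub contDiff_const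
    exact h1.comp h2
  set lam : E → ℝ := fun y => c + χ y * (G y - c) with hlam
  have hlam0 : lam 0 = c := by
    simp only [hlam]; rw [hχz 0 (by simp; positivity)]; simp
  have hlamc : ∀ y, c ≤ lam y := fun y => by
    by_cases hy : y = 0
    · rw [hy, hlam0]
    · have := mul_nonneg (hχ0 y) (sub_nonneg.2 (hGc y hy))
      simp only [hlam]; linarith
  have hlams : ContDiff ℝ 3 lam := by
    rw [contDiff_iff_contDiffAt]
    intro y
    by_cases hy : y = 0
    · have : lam =ᶠ[𝓝 y] fun _ => c := by
        have h1 : ∀ᶠ z : E in 𝓝 y, 2 * ‖z‖ ^ 2 < r ^ 2 := by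
          have h2 : Continuous fun z : E => 2 * ‖z‖ ^ 2 := by fun_prop
          refine h2.continuousAt.eventually_lt continuousAt_const ?_
          rw [hy]; simp; positivity
        filter_upwards [h1] with z hz
        simp only [hlam, hχz z hz.le]; ring
      exact contDiffAt_const.congr_of_eventuallyEq this
    · have h1 : ContDiffAt ℝ 3 G y :=
        (gauge_contDiffAt ho hconv h0 hb hC hy).mul
          ((contDiffAt_norm ℝ hy).inv (norm_ne_zero_iff.2 hy))
      exact contDiffAt_const.add (hχs.contDiffAt.mul (h1.sub contDiffAt_const))
  have hm : ∀ y, ∀ s t : ℝ, 0 ≤ s → s ≤ t → c * (t - s) ≤ t * lam (t • y) - s * lam (s • y) := by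
    intro y s t hs hst
    by_cases hy : y = 0
    · rw [hy]; simp only [smul_zero, hlam0]; linarith
    rcases hs.eq_or_lt with hs0 | hs0
    · rw [← hs0]
      have := mul_le_mul_of_nonneg_left (hlamc (t • y)) (hs.trans hst)
      linarith
    have ht0 : 0 < t := hs0.trans_le hst
    simp only [hlam]
    rw [hGh y t ht0, hGh y s hs0]
    have h1 : s * χ (s • y) ≤ t * χ (t • y) := by
      apply mul_le_mul hst _ (hχ0 _) ht0.le
      apply hχm
      rw [norm_smul, norm_smul, Real.norm_of_nonneg hs, Real.norm_of_nonneg ht0.le]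
      gcongr
    have h2 := mul_le_mul_of_nonneg_right h1 (sub_nonneg.2 (hGc y hy))
    nlinarith
  set Φ : E → E := fun y => lam y • y with hΦ
  have hΦs : ContDiff ℝ 3 Φ := hlams.smul contDiff_id
  have hnorm : ∀ y, ‖Φ y‖ = lam y * ‖y‖ := fun y => by
    simp only [hΦ]; rw [norm_smul, Real.norm_of_nonneg (hc.le.trans (hlamc y))]
  have hS : ∀ y, y ∈ S ↔ ‖Φ y‖ < 1 := by
    intro y
    rw [hnorm]
    by_cases hy : y = 0
    · simp [hy, h0]
    have hyp := norm_pos_iff.2 hy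
    by_cases hyr : r ≤ ‖y‖
    · have : lam y * ‖y‖ = gauge S y := by
        simp only [hlam, hχo y hyr, hGdef]; field_simp; ring
      rw [this, hg1]
    · have hyS : y ∈ S := hrS (by simpa using hyr)
      have h1 : lam y * ‖y‖ ≤ gauge S y := by
        have h2 : lam y ≤ G y := by
          have := mul_le_mul_of_nonneg_right (hχ1 y) (sub_nonneg.2 (hGc y hy))
          simp only [hlam]; linarith
        have h3 : G y * ‖y‖ = gauge S y := by simp only [hGdef]; field_simp
        rw [← h3]; gcongr
      exact iff_of_true hyS (h1.trans_lt ((hg1 y).1 hyS))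
  have hinj : Function.Injective Φ := by
    intro y z hyz
    have ly := hc.trans_le (hlamc y)
    have lz := hc.trans_le (hlamc z)
    simp only [hΦ] at hyz
    set s := lam y / lam z with hs
    have hsp : 0 < s := div_pos ly lz
    have hz : z = s • y := by
      have := congrArg (fun w => (lam z)⁻¹ • w) hyz
      simp only [smul_smul, inv_mul_cancel₀ lz.ne', one_smul] at this
      rw [← this, hs, div_eq_inv_mul]
    have e : s * lam (s • y) = lam y := by
      rw [← hz, hs]; field_simp
    have e1 : s = 1 := by
      rcases le_total s 1 with h | h
      · have := hm y s 1 hsp.le h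
        rw [e, one_smul, one_mul, sub_self] at this
        nlinarith
      · have := hm y 1 s zero_le_one h
        rw [e, one_smul, one_mul, sub_self] at this
        nlinarith
    rw [hz, e1, one_smul]
  have hsurj : Function.Surjective Φ := by
    intro z
    have hcm : Continuous fun t : ℝ => t * lam (t • z) :=
      continuous_id.mul (hlams.continuous.comp (by fun_prop))
    have h1 : (1 : ℝ) ∈ Icc ((fun t : ℝ => t * lam (t • z)) 0) ((fun t : ℝ => t * lam (t • z)) c⁻¹) := by
      constructor
      · simp
      · have := mul_le_mul_of_nonneg_left (hlamc (c⁻¹ • z)) (inv_pos.2 hc).le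
        rwa [inv_mul_cancel₀ hc.ne'] at this
    obtain ⟨t, -, ht⟩ := intermediate_value_Icc (inv_pos.2 hc).le hcm.continuousOn h1
    refine ⟨t • z, ?_⟩
    simp only [hΦ]
    rw [smul_smul, mul_comm]
    change (t * lam (t • z)) = 1 at ht
    rw [ht, one_smul]
  have hder : ∀ y, ∃ e : E ≃L[ℝ] E, HasFDerivAt Φ (e : E →L[ℝ] E) y := by
    intro y
    have hl : HasFDerivAt lam (fderiv ℝ lam y) y :=
      (hlams.differentiable (by simp) y).hasFDerivAt
    have hP : HasFDerivAt Φ (lam y • ContinuousLinearMap.id ℝ E + (fderiv ℝ lam y).smulRight y) y :=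
      hl.smul (hasFDerivAt_id y)
    set L := lam y • ContinuousLinearMap.id ℝ E + (fderiv ℝ lam y).smulRight y with hL
    have hLv : ∀ v, L v = lam y • v + (fderiv ℝ lam y v) • y := fun v => by simp [hL]
    have hrad : c ≤ lam y + fderiv ℝ lam y y := by
      have h1 : HasDerivAt (fun t : ℝ => t • y) y 1 := by
        simpa using (hasDerivAt_id (1 : ℝ)).smul_const y
      have h2 : HasDerivAt (fun t : ℝ => lam (t • y)) (fderiv ℝ lam y y) 1 := by
        have hl' : HasFDerivAt lam (fderiv ℝ lam y) ((1 : ℝ) • y) := by simpa using hl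
        exact hl'.comp_hasDerivAt (1 : ℝ) h1
      have h3 : HasDerivAt (fun t : ℝ => t * lam (t • y)) (lam y + fderiv ℝ lam y y) 1 := by
        have := (hasDerivAt_id (1 : ℝ)).mul h2
        simp only [id, one_smul, one_mul] at this
        exact this
      refine slope_bound h3 ?_
      filter_upwards [self_mem_nhdsWithin] with t ht
      exact hm y 1 t zero_le_one (le_of_lt ht)
    have lp := hc.trans_le (hlamc y)
    have hLi : Function.Injective (L : E →ₗ[ℝ] E) := by
      rw [injective_iff_map_eq_zero]
      intro v hv
      change L v = 0 at hv
      rw [hLv] at hv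
      set a := fderiv ℝ lam y v with ha
      have hv2 : v = (-(a / lam y)) • y := by
        have := congrArg (fun w => (lam y)⁻¹ • w) hv
        simp only [smul_add, smul_smul, inv_mul_cancel₀ lp.ne', one_smul, smul_zero] at this
        rw [neg_smul, div_eq_inv_mul]
        exact eq_neg_of_add_eq_zero_left this
      have ha2 : a = -(a / lam y) * fderiv ℝ lam y y := by
        conv_lhs => rw [ha, hv2, map_smul, smul_eq_mul]
      have ha3 : a * (lam y + fderiv ℝ lam y y) = 0 := by
        field_simp at ha2
        linarith
      have ha4 : a = 0 := by
        rcases mul_eq_zero.1 ha3 with h | h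
        · exact h
        · linarith
      rw [hv2, ha4]; simp
    refine ⟨(LinearEquiv.ofInjectiveEndo (L : E →ₗ[ℝ] E) hLi).toContinuousLinearEquiv, ?_⟩
    convert hP using 1
    ext v
    rfl
  choose e he using hder
  have hopen : IsOpenMap Φ := by
    refine isOpenMap_of_hasStrictFDerivAt_equiv (𝕜 := ℝ) (f' := e) fun y => ?_
    exact hΦs.contDiffAt.hasStrictFDerivAt' (he y) (by simp)
  let H : E ≃ₜ E := (Equiv.ofBijective Φ ⟨hinj, hsurj⟩).toHomeomorphOfContinuousOpen
    hΦs.continuous hopen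
  have hΨs : ContDiff ℝ 3 H.symm := H.contDiff_symm (f₀' := e) he hΦs
  have hlr : ∀ x, H.symm (Φ x) = x := fun x => H.symm_apply_apply x
  have hrl : ∀ x, Φ (H.symm x) = x := fun x => H.apply_symm_apply x
  have hhom : ∀ y, r ≤ ‖y‖ → ∀ t : ℝ, 1 ≤ t → Φ (t • y) = t • Φ y := by
    intro y hy t ht
    have ht0 : 0 < t := by linarith
    have hty : r ≤ ‖t • y‖ := by
      rw [norm_smul, Real.norm_of_nonneg ht0.le]; nlinarith [norm_nonneg y]
    simp only [hΦ, hlam]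
    rw [hχo y hy, hχo _ hty, hGh y t ht0, smul_smul, smul_smul, mul_comm]
  refine ⟨Φ, H.symm, hlr, hrl, hΦs, hΨs, ?_, ?_, hS⟩
  · exact bound_of_homog (hΦs.of_le (by norm_num)) r hr hhom
  · refine bound_of_homog (hΨs.of_le (by norm_num)) 1 one_pos ?_
    intro z hz t ht
    apply hinj
    have h1 : r ≤ ‖H.symm z‖ := by
      by_contra hlt
      have : H.symm z ∈ S := hrS (by simpa using hlt)
      rw [hS, hrl] at this
      linarith
    rw [hrl, hhom _ h1 t ht, hrl]

lemma projTail_contDiff (d : ℕ) : ContDiff ℝ 3 (projTail d) := by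
  unfold projTail
  refine (EuclideanSpace.equiv (Fin (d - 1)) ℝ).symm.contDiff.comp ?_
  rw [contDiff_pi]
  intro i
  fun_prop

lemma projTail_e1 (d : ℕ) (hd : 2 ≤ d) (t : ℝ) : projTail d (t • e1 d) = 0 := by
  have h : 0 < d := by omega
  ext i
  simp [projTail, e1, h]

lemma inner_e1 (d : ℕ) (hd : 2 ≤ d) : ⟪e1 d, e1 d⟫ = 1 := by
  have h : 0 < d := by omega
  simp [e1, h]

lemma chart_fun {d : ℕ} {D : Set (EuclideanSpace ℝ (Fin d))} {ε₀ η : ℝ}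
    {n : EuclideanSpace ℝ (Fin d) → EuclideanSpace ℝ (Fin d)}
    (hD : AssumptionD d D ε₀ η n) (x : EuclideanSpace ℝ (Fin d)) (hx : x ∈ frontier D) :
    ∃ h : EuclideanSpace ℝ (Fin d) → ℝ, ContDiffAt ℝ 3 h x ∧ fderiv ℝ h x ≠ 0 ∧
      ∀ᶠ z in 𝓝 x, (z ∈ D ↔ 0 < h z) := by
  obtain ⟨A₀, -, ψ, hψ, -, -, -, -, -, hset⟩ := hD.chart x hx
  let A := A₀.toLinearIsometryEquiv rfl
  have hA : ∀ u, A u = A₀ u := fun u => rfl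
  let h : EuclideanSpace ℝ (Fin d) → ℝ := fun z =>
    ⟪A.symm (z - x), e1 d⟫ - ψ (projTail d (A.symm (z - x)))
  have hP := projTail_contDiff d
  have hp0 : projTail d 0 = 0 := by simpa using projTail_e1 d hD.dim_ge 0
  have hAs : ContDiff ℝ 3 (fun z => A.symm (z - x)) :=
    A.symm.contDiff.comp (contDiff_id.sub contDiff_const)
  have hh : ContDiffAt ℝ 3 h x := by
    have hψ0 : ContDiffAt ℝ 3 ψ 0 := hψ.contDiffAt (ball_mem_nhds _ hD.eps_pos)
    have h1 : ContDiffAt ℝ 3 ψ ((fun z => projTail d (A.symm (z - x))) x) := by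
      simpa [hp0] using hψ0
    exact (hAs.inner ℝ contDiff_const).contDiffAt.sub
      (h1.comp x (hP.comp hAs).contDiffAt)
  refine ⟨h, hh, ?_, ?_⟩
  · intro h0
    have hd : HasFDerivAt h (fderiv ℝ h x) (x + (0 : ℝ) • A (e1 d)) := by
      simpa using (hh.differentiableAt (by simp)).hasFDerivAt
    have h1 : HasDerivAt (fun t : ℝ => x + t • A (e1 d)) (A (e1 d)) 0 := by
      simpa using ((hasDerivAt_id (0 : ℝ)).smul_const (A (e1 d))).const_add x
    have h2 : HasDerivAt (fun t : ℝ => h (x + t • A (e1 d))) (fderiv ℝ h x (A (e1 d))) 0 := by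
      have h2' := hd.comp_hasDerivAt (0 : ℝ) h1
      exact h2'
    have h3 : (fun t : ℝ => h (x + t • A (e1 d))) = fun t => t - ψ 0 := by
      ext t
      simp only [h, add_sub_cancel_left, map_smul, LinearIsometryEquiv.symm_apply_apply,
        projTail_e1 d hD.dim_ge, real_inner_smul_left, inner_e1 d hD.dim_ge, mul_one]
    rw [h3] at h2
    have h4 := h2.unique ((hasDerivAt_id (0 : ℝ)).sub_const (ψ 0))
    rw [h0] at h4
    simp at h4
  · filter_upwards [ball_mem_nhds x hD.eps_pos] with z hz
    have h1 : z ∈ D ↔ z ∈ D ∩ ball x ε₀ := ⟨fun h => ⟨h, hz⟩, fun h => h.1⟩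
    rw [h1, hset]
    constructor
    · rintro ⟨u, ⟨-, hu⟩, rfl⟩
      simp only [h, add_sub_cancel_left, ← hA, LinearIsometryEquiv.symm_apply_apply]
      linarith
    · intro hpos
      refine ⟨A.symm (z - x), ⟨?_, ?_⟩, ?_⟩
      · rw [mem_ball_zero_iff, LinearIsometryEquiv.norm_map]
        exact mem_ball_iff_norm.1 hz
      · exact sub_pos.1 hpos
      · simp only [← hA, LinearIsometryEquiv.apply_symm_apply]
        abel

end aux

/-- if `D ⊂ ℝ^d` satisfies Assumption (D), there is a `C³` diffeomorphism
`Φ : ℝ^d → ℝ^d`, with `DΦ` and `DΦ⁻¹` bounded, mapping `D` onto `B(0,1)`; consequently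
`Φ` is globally bi-Lipschitz: `κ⁻¹|x−y| ≤ |Φx − Φy| ≤ κ|x−y|` for some `κ > 0`. -/
theorem stmt_11 (d : ℕ) (D : Set (EuclideanSpace ℝ (Fin d))) (ε₀ η : ℝ)
    (n : EuclideanSpace ℝ (Fin d) → EuclideanSpace ℝ (Fin d))
    (hD : AssumptionD d D ε₀ η n) :
    ∃ Φ Ψ : EuclideanSpace ℝ (Fin d) → EuclideanSpace ℝ (Fin d),
      (∀ x, Ψ (Φ x) = x) ∧ (∀ x, Φ (Ψ x) = x) ∧
      ContDiff ℝ 3 Φ ∧ ContDiff ℝ 3 Ψ ∧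
      (∃ M : ℝ, ∀ x, ‖fderiv ℝ Φ x‖ ≤ M) ∧
      (∃ M : ℝ, ∀ x, ‖fderiv ℝ Ψ x‖ ≤ M) ∧
      Φ '' D = Metric.ball (0 : EuclideanSpace ℝ (Fin d)) 1 ∧
      ∃ κ : ℝ, 0 < κ ∧ ∀ x y : EuclideanSpace ℝ (Fin d),
        κ⁻¹ * ‖x - y‖ ≤ ‖Φ x - Φ y‖ ∧ ‖Φ x - Φ y‖ ≤ κ * ‖x - y‖ := by
  obtain ⟨x₀, hx₀⟩ := hD.nonempty
  set τ : EuclideanSpace ℝ (Fin d) ≃ₜ EuclideanSpace ℝ (Fin d) := Homeomorph.addLeft x₀ with hτ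
  have hτa : ∀ z, τ z = x₀ + z := fun z => rfl
  set S : Set (EuclideanSpace ℝ (Fin d)) := τ ⁻¹' D with hS
  have ho : IsOpen S := hD.isOpen.preimage τ.continuous
  have hconv : Convex ℝ S := hD.convex.translate_preimage_right x₀
  have h0 : (0 : EuclideanSpace ℝ (Fin d)) ∈ S := by
    change x₀ + 0 ∈ D
    simpa using hx₀
  have hb : Bornology.IsBounded S := by
    obtain ⟨R, hR⟩ := hD.isBounded.subset_closedBall x₀
    refine (Metric.isBounded_closedBall (x := 0) (r := R)).subset fun z hz => ?_
    have := hR hz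
    simpa [hτa, mem_closedBall_iff_norm] using this
  have hC : ∀ x ∈ frontier S, ∃ h : EuclideanSpace ℝ (Fin d) → ℝ, ContDiffAt ℝ 3 h x ∧
      fderiv ℝ h x ≠ 0 ∧ ∀ᶠ z in nhds x, (z ∈ S ↔ 0 < h z) := by
    intro x hx
    rw [hS, ← τ.preimage_frontier] at hx
    obtain ⟨h, h1, h2, h3⟩ := chart_fun hD (τ x) hx
    refine ⟨fun z => h (x₀ + z), ?_, ?_, ?_⟩
    · have h1' : ContDiffAt ℝ 3 h ((fun z => x₀ + z) x) := h1
      exact h1'.comp x (contDiff_const.add contDiff_id).contDiffAt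
    · rw [fderiv_comp_add_left]; exact h2
    · exact τ.continuous.continuousAt.eventually h3
  obtain ⟨Φ, Ψ, hl, hr, hΦ, hΨ, ⟨M, hM⟩, ⟨N, hN⟩, hin⟩ := radial_diffeo ho hconv h0 hb hC
  have hMd : ∀ x, ‖fderiv ℝ (fun z => Φ (z - x₀)) x‖ ≤ M := fun x => by
    rw [fderiv_comp_sub]; exact hM _
  have hNd : ∀ x, ‖fderiv ℝ (fun z => x₀ + Ψ z) x‖ ≤ N := fun x => by
    rw [fderiv_const_add]; exact hN _
  have hΦ' : ContDiff ℝ 3 (fun z => Φ (z - x₀)) := hΦ.comp (contDiff_id.sub contDiff_const)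
  have hΨ' : ContDiff ℝ 3 (fun z => x₀ + Ψ z) := contDiff_const.add hΨ
  have hlr : ∀ x, x₀ + Ψ (Φ (x - x₀)) = x := fun x => by rw [hl]; abel
  refine ⟨fun z => Φ (z - x₀), fun z => x₀ + Ψ z, hlr, fun x => ?_, hΦ', hΨ',
    ⟨M, hMd⟩, ⟨N, hNd⟩, ?_, max (max M N) 1, by positivity, fun x y => ⟨?_, ?_⟩⟩
  · simp only [add_sub_cancel_left, hr]
  · ext z
    simp only [mem_image, mem_ball_zero_iff]
    constructor
    · rintro ⟨x, hx, rfl⟩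
      rw [← hin]
      change x₀ + (x - x₀) ∈ D
      simpa using hx
    · intro hz
      refine ⟨x₀ + Ψ z, ?_, by simp [hr]⟩
      change Ψ z ∈ S
      rw [hin, hr]; exact hz
  · rw [inv_mul_le_iff₀ (by positivity)]
    have h1 := convex_univ.norm_image_sub_le_of_norm_fderiv_le (𝕜 := ℝ)
      (f := fun z => x₀ + Ψ z) (C := N) (x := Φ (y - x₀)) (y := Φ (x - x₀))
      (fun z _ => hΨ'.differentiable (by simp) z) (fun z _ => hNd z) (mem_univ _) (mem_univ _)
    simp only [hlr] at h1
    refine h1.trans ?_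
    gcongr
    exact (le_max_right M N).trans (le_max_left _ _)
  · have h1 := convex_univ.norm_image_sub_le_of_norm_fderiv_le (𝕜 := ℝ)
      (f := fun z => Φ (z - x₀)) (C := M) (x := y) (y := x)
      (fun z _ => hΦ'.differentiable (by simp) z) (fun z _ => hMd z) (mem_univ _) (mem_univ _)
    refine h1.trans ?_
    gcongr
    exact (le_max_left M N).trans (le_max_left _ _)
end
end
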